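/- For a > 0 define ψ(ξ,0) = cosh^a(ξ/a) and for τ > 0 let ψ(ξ,τ) = (4πτ)^{-1/2} ∫_ℝ e^{-(ξ-η)²/(4τ)} cosh^a(η/a) dη, and set w(ξ,τ) = ∂_ξψ(ξ,τ)/ψ(ξ,τ). Fix δ > 0. Then: (i) there exist A > 0 and C > 0 such that for all a ≥ A, sup_{ξ ∈ ℝ} |w(ξ,τ) - tanh(ξ)| ≤ C a^{-(3δ+δ²)} τ^{-1/2} for all τ ≥ (1/2)(1+δ)² a log(a); and (ii) for every integer m ≥ 0 there exist A_m > 0 and C_m > 0 such that for all a ≥ A_m, |∂_ξ^m ( w(ξ,τ) - tanh(ξ) )| ≤ C_m a^{-(1+m+δ)} for all |ξ| ≥ (1/2)(1+δ)² a log(a) and all τ ≥ 0. -/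

import Mathlib

open Real MeasureTheory

/-- Heat-equation solution with initial data `cosh^a(ξ/a)`, given by the heat kernel
for `τ > 0`. -/
noncomputable def ψ (a ξ τ : ℝ) : ℝ :=
  if τ = 0 then Real.cosh (ξ/a) ^ a
  else (4 * Real.pi * τ) ^ (-(1:ℝ)/2) *
    ∫ η : ℝ, Real.exp (-(ξ - η) ^ 2 / (4 * τ)) * Real.cosh (η/a) ^ a

/-- The corresponding Burgers solution `w = ∂_ξψ/ψ` with initial data `tanh(ξ/a)`. -/
noncomputable def w (a ξ τ : ℝ) : ℝ :=
  deriv (fun y => ψ a y τ) ξ / ψ a ξ τ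

open ProbabilityTheory in
/-- The Gaussian of mean `2τ` and variance `2τ`, which arises from the heat kernel at time `τ`
after an exponential tilt. -/
noncomputable def tiltedGaussian (τ : ℝ) : Measure ℝ :=
  gaussianReal (2 * τ) (2 * τ).toNNReal

instance (τ : ℝ) : IsProbabilityMeasure (tiltedGaussian τ) := by
  unfold tiltedGaussian; infer_instance

/-- The function `(a x)^i (1 + x)^(a - i)` in the variable `x = exp (-2η/a)`. -/
noncomputable def shockWeight (a : ℝ) (i : ℕ) (η : ℝ) : ℝ :=
  (a * exp (-2 * η / a)) ^ i * (1 + exp (-2 * η / a)) ^ (a - i)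

/-- The average of `shockWeight a i` over the tilted Gaussian recentred at `ξ`. -/
noncomputable def shockMoment (a τ : ℝ) (i : ℕ) (ξ : ℝ) : ℝ :=
  ∫ z, shockWeight a i (ξ + z) ∂tiltedGaussian τ

theorem integrable_exp_tiltedGaussian (τ c ξ : ℝ) :
    Integrable (fun z => exp (-c * (ξ + z))) (tiltedGaussian τ) := by
  have h := (ProbabilityTheory.integrable_exp_mul_gaussianReal (μ := 2 * τ)
    (v := (2 * τ).toNNReal) (-c)).const_mul (exp (-c * ξ))
  refine h.congr (.of_forall fun z => ?_)
  simp only [← Real.exp_add]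
  ring_nf

theorem integral_exp_tiltedGaussian {τ : ℝ} (hτ : 0 ≤ τ) (c ξ : ℝ) :
    ∫ z, exp (-c * (ξ + z)) ∂tiltedGaussian τ = exp (-c * ξ - c * (2 - c) * τ) := by
  have h := congrFun (ProbabilityTheory.mgf_id_gaussianReal (μ := 2 * τ)
    (v := (2 * τ).toNNReal)) (-c)
  simp only [ProbabilityTheory.mgf, id] at h
  have h2 : ∀ z, exp (-c * (ξ + z)) = exp (-c * ξ) * exp (-c * z) := fun z => by
    rw [← Real.exp_add]; ring_nf
  simp only [h2]
  rw [integral_const_mul, tiltedGaussian, h, ← Real.exp_add, Real.coe_toNNReal _ (by linarith)]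
  ring_nf

theorem hasDerivAt_shockWeight {a : ℝ} (ha : 0 < a) (i : ℕ) (η : ℝ) :
    HasDerivAt (shockWeight a i)
      (-2 / a * (i * shockWeight a i η + (1 - i / a) * shockWeight a (i + 1) η)) η := by
  have hx : HasDerivAt (fun η : ℝ => exp (-2 * η / a)) (exp (-2 * η / a) * (-2 / a)) η := by
    have h : HasDerivAt (fun η : ℝ => -2 * η / a) (-2 / a) η := by
      simpa using ((hasDerivAt_id η).const_mul (-2)).div_const a
    exact h.exp
  have h1 := (hx.const_mul a).pow i
  have h2 := (hx.const_add 1).rpow_const (p := a - i)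
    (Or.inl (by positivity : (1 + exp (-2 * η / a)) ≠ 0))
  refine (h1.mul h2).congr_deriv ?_
  simp only [shockWeight, Pi.pow_apply]
  have e : a - (i : ℝ) - 1 = a - ((i + 1 : ℕ) : ℝ) := by push_cast; ring
  rw [e]
  cases i with
  | zero => simp; field_simp
  | succ n =>
    simp only [Nat.add_sub_cancel]
    push_cast
    field_simp
    ring

theorem continuous_shockWeight {a : ℝ} (ha : 0 < a) (i : ℕ) : Continuous (shockWeight a i) :=
  continuous_iff_continuousAt.2 fun η => (hasDerivAt_shockWeight ha i η).continuousAt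

theorem shockWeight_pos {a : ℝ} (ha : 0 < a) (i : ℕ) (η : ℝ) : 0 < shockWeight a i η := by
  unfold shockWeight; positivity

theorem exp_rpow_eq {a : ℝ} (ha : 0 < a) (η : ℝ) : exp (-2 * η / a) ^ a = exp (-2 * η) := by
  rw [← Real.exp_mul]; congr 1; field_simp

theorem shockWeight_le {a : ℝ} (ha : 0 < a) (i : ℕ) (η : ℝ) :
    shockWeight a i η ≤ a ^ i * 2 ^ a * (1 + exp (-2 * η)) := by
  have hx : 0 < exp (-2 * η / a) := exp_pos _
  rw [← exp_rpow_eq ha]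
  unfold shockWeight
  set x := exp (-2 * η / a)
  have h1 : (a * x) ^ i * (1 + x) ^ (a - i) ≤ a ^ i * (1 + x) ^ a := by
    rw [Real.rpow_sub (by positivity), Real.rpow_natCast, mul_pow, mul_assoc]
    have : x ^ i ≤ (1 + x) ^ i := by gcongr; linarith
    have h3 : x ^ i * ((1 + x) ^ a / (1 + x) ^ i) ≤ (1 + x) ^ a := by
      rw [mul_div_assoc', div_le_iff₀ (by positivity), mul_comm]
      gcongr
    gcongr
  have h2 : (1 + x) ^ a ≤ 2 ^ a * (1 + x ^ a) := by
    rcases le_total x 1 with h | h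
    · calc (1 + x) ^ a ≤ 2 ^ a := by gcongr; linarith
        _ ≤ _ := le_mul_of_one_le_right (by positivity) (by
          have : 0 < x ^ a := by positivity
          linarith)
    · calc (1 + x) ^ a ≤ (2 * x) ^ a := by gcongr; linarith
        _ = 2 ^ a * x ^ a := Real.mul_rpow (by norm_num) hx.le
        _ ≤ _ := by gcongr; linarith
  calc _ ≤ _ := h1
    _ ≤ a ^ i * (2 ^ a * (1 + x ^ a)) := by gcongr
    _ = _ := by ring

theorem integrable_shockWeight {a : ℝ} (ha : 0 < a) (τ : ℝ) (i : ℕ) (ξ : ℝ) :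
    Integrable (fun z => shockWeight a i (ξ + z)) (tiltedGaussian τ) := by
  have hi := ((integrable_const (1 : ℝ)).add
    (integrable_exp_tiltedGaussian τ 2 ξ)).const_mul (a ^ i * 2 ^ a)
  refine hi.mono' (((continuous_shockWeight ha i).comp
    (continuous_const.add continuous_id)).aestronglyMeasurable) (.of_forall fun z => ?_)
  rw [Real.norm_of_nonneg (shockWeight_pos ha i _).le]
  exact shockWeight_le ha i _

theorem hasDerivAt_shockMoment {a : ℝ} (ha : 0 < a) (τ : ℝ) (i : ℕ) (ξ : ℝ) :
    HasDerivAt (shockMoment a τ i)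
      (-2 / a * (i * shockMoment a τ i ξ + (1 - i / a) * shockMoment a τ (i + 1) ξ)) ξ := by
  have hc : ∀ j x, AEStronglyMeasurable (fun z => shockWeight a j (x + z)) (tiltedGaussian τ) :=
    fun j x => (integrable_shockWeight ha τ j x).aestronglyMeasurable
  let B : ℕ → ℝ → ℝ := fun j z => a ^ j * 2 ^ a * (1 + exp (-2 * ((ξ - 1) + z)))
  have hB : ∀ j z, ∀ x ∈ Metric.ball ξ 1, |shockWeight a j (x + z)| ≤ B j z := by
    intro j z x hx
    rw [abs_of_pos (shockWeight_pos ha j _)]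
    refine (shockWeight_le ha j _).trans ?_
    have : ξ - 1 ≤ x := by
      have := abs_lt.1 (Real.dist_eq x ξ ▸ Metric.mem_ball.1 hx)
      linarith
    have h3 : -2 * (x + z) ≤ -2 * (ξ - 1 + z) := by linarith
    simp only [B]
    gcongr
  have hBi : ∀ j, Integrable (B j) (tiltedGaussian τ) := fun j =>
    ((integrable_const (1 : ℝ)).add
      (integrable_exp_tiltedGaussian τ 2 (ξ - 1))).const_mul (a ^ j * 2 ^ a)
  have key := hasDerivAt_integral_of_dominated_loc_of_deriv_le (μ := tiltedGaussian τ)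
    (F := fun x z => shockWeight a i (x + z))
    (F' := fun x z => -2 / a * (i * shockWeight a i (x + z) +
      (1 - i / a) * shockWeight a (i + 1) (x + z)))
    (bound := fun z => |-2 / a| * (i * B i z + |1 - i / a| * B (i + 1) z))
    (Metric.ball_mem_nhds ξ one_pos) (.of_forall fun x => hc i x)
    (integrable_shockWeight ha τ i ξ)
    ((((hc i ξ).const_mul _).add ((hc (i + 1) ξ).const_mul _)).const_mul _)
    (.of_forall fun z x hx => ?_)
    ((((hBi i).const_mul _).add ((hBi (i + 1)).const_mul _)).const_mul _)
    (.of_forall fun z x _ => (hasDerivAt_shockWeight ha i (x + z)).comp_add_const x z)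
  · refine key.2.congr_deriv ?_
    rw [integral_const_mul, integral_add ((integrable_shockWeight ha τ i ξ).const_mul _)
      ((integrable_shockWeight ha τ (i + 1) ξ).const_mul _), integral_const_mul,
      integral_const_mul]
    rfl
  · rw [Real.norm_eq_abs, abs_mul]
    refine mul_le_mul_of_nonneg_left ((abs_add_le _ _).trans (add_le_add ?_ ?_)) (abs_nonneg _)
    · rw [abs_mul, Nat.abs_cast]
      exact mul_le_mul_of_nonneg_left (hB i z x hx) (Nat.cast_nonneg _)
    · rw [abs_mul]
      exact mul_le_mul_of_nonneg_left (hB (i + 1) z x hx) (abs_nonneg _)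

theorem contDiff_shockMoment {a : ℝ} (ha : 0 < a) (τ : ℝ) (i n : ℕ) :
    ContDiff ℝ n (shockMoment a τ i) := by
  induction n generalizing i with
  | zero =>
    exact contDiff_zero.2 (continuous_iff_continuousAt.2 fun ξ =>
      (hasDerivAt_shockMoment ha τ i ξ).continuousAt)
  | succ n ih =>
    push_cast
    refine contDiff_succ_iff_deriv.2
      ⟨fun ξ => (hasDerivAt_shockMoment ha τ i ξ).differentiableAt, by simp, ?_⟩
    rw [funext fun ξ => (hasDerivAt_shockMoment ha τ i ξ).deriv]
    exact contDiff_const.mul ((contDiff_const.mul (ih i)).add (contDiff_const.mul (ih (i + 1))))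

theorem one_le_shockMoment {a : ℝ} (ha : 0 < a) (τ ξ : ℝ) : 1 ≤ shockMoment a τ 0 ξ := by
  have h : ∀ z, 1 ≤ shockWeight a 0 (ξ + z) := fun z => by
    simp only [shockWeight, pow_zero, one_mul, Nat.cast_zero, sub_zero]
    exact Real.one_le_rpow (by linarith [exp_pos (-2 * (ξ + z) / a)]) ha.le
  calc (1 : ℝ) = ∫ _, (1 : ℝ) ∂tiltedGaussian τ := by simp
    _ ≤ _ := integral_mono (integrable_const _) (integrable_shockWeight ha τ 0 ξ) h

theorem shockMoment_nonneg {a : ℝ} (ha : 0 < a) (τ : ℝ) (i : ℕ) (ξ : ℝ) :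
    0 ≤ shockMoment a τ i ξ :=
  integral_nonneg fun _ => (shockWeight_pos ha i _).le

/-- Pointwise bound of `shockWeight a i` by two exponentials whose tilted Gaussian averages
do not grow in time. -/
theorem shockWeight_le_exp {a : ℝ} (ha : 0 < a) {i : ℕ} (hi : (i : ℝ) ≤ a) (η : ℝ) :
    shockWeight a i η ≤ exp 1 * a ^ i * exp (-(2 * i / a) * η) +
      exp 1 * a ^ a * exp (-2 * η) := by
  have hx : 0 < exp (-2 * η / a) := exp_pos _
  have e1 : exp (-(2 * i / a) * η) = exp (-2 * η / a) ^ i := by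
    rw [← Real.exp_nat_mul]; congr 1; ring
  rw [← exp_rpow_eq ha, e1]
  unfold shockWeight
  set x := exp (-2 * η / a)
  have hb : 0 ≤ a - i := by linarith
  have hpow : (1 + 1 / a) ^ (a - i) ≤ exp 1 := by
    calc (1 + 1 / a) ^ (a - i) ≤ (exp (1 / a)) ^ (a - i) := by
          gcongr; linarith [Real.add_one_le_exp (1 / a)]
      _ = exp (1 / a * (a - i)) := (Real.exp_mul _ _).symm
      _ ≤ exp 1 := by
          gcongr
          rw [one_div_mul_eq_div, div_le_one ha]
          linarith [(Nat.cast_nonneg i : (0 : ℝ) ≤ i)]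
  have hE := exp_pos 1
  rcases le_total x (1 / a) with h | h
  · have h1 : (1 + x) ^ (a - i) ≤ exp 1 := le_trans (by gcongr) hpow
    have : 0 ≤ exp 1 * a ^ a * x ^ a := by positivity
    rw [mul_pow]
    nlinarith [mul_le_mul_of_nonneg_left h1 (by positivity : 0 ≤ a ^ i * x ^ i)]
  · have hax : 1 ≤ a * x := by rwa [div_le_iff₀' ha] at h
    have h1 : (1 + x) ^ (a - i) ≤ exp 1 * (a * x) ^ (a - i) := by
      calc (1 + x) ^ (a - i) ≤ ((1 + 1 / a) * (a * x)) ^ (a - i) := by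
            gcongr
            have : (1 + 1 / a) * (a * x) = a * x + x := by field_simp
            linarith
        _ = (1 + 1 / a) ^ (a - i) * (a * x) ^ (a - i) :=
            Real.mul_rpow (by positivity) (by positivity)
        _ ≤ _ := by gcongr
    have h2 : (a * x) ^ i * (a * x) ^ (a - i) = a ^ a * x ^ a := by
      rw [← Real.rpow_natCast, ← Real.rpow_add (by positivity), ← Real.mul_rpow ha.le hx.le]
      congr 1; ring
    have h3 : 0 ≤ exp 1 * a ^ i * x ^ i := by positivity
    have h4 := mul_le_mul_of_nonneg_left h1 (by positivity : 0 ≤ (a * x) ^ i)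
    have h5 : (a * x) ^ i * (exp 1 * (a * x) ^ (a - i)) = exp 1 * (a ^ a * x ^ a) := by
      rw [← h2]; ring
    nlinarith

theorem shockMoment_le {a τ ξ : ℝ} (ha : 0 < a) (hτ : 0 ≤ τ) {i : ℕ} (hi : (i : ℝ) ≤ a)
    (hy : a * exp (-2 * ξ / a) ≤ 1) :
    shockMoment a τ i ξ ≤ 2 * exp 1 * (a * exp (-2 * ξ / a)) ^ i := by
  have hint1 := (integrable_exp_tiltedGaussian τ (2 * i / a) ξ).const_mul (exp 1 * a ^ i)
  have hint2 := (integrable_exp_tiltedGaussian τ 2 ξ).const_mul (exp 1 * a ^ a)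
  have h := integral_mono (integrable_shockWeight ha τ i ξ) (hint1.add hint2)
    fun z => shockWeight_le_exp ha hi (ξ + z)
  simp only [Pi.add_apply] at h
  rw [integral_add hint1 hint2, integral_const_mul, integral_const_mul,
    integral_exp_tiltedGaussian hτ, integral_exp_tiltedGaussian hτ] at h
  refine h.trans ?_
  have e1 : exp (-(2 * i / a) * ξ - 2 * i / a * (2 - 2 * i / a) * τ) ≤ exp (-2 * ξ / a) ^ i := by
    rw [← Real.exp_nat_mul]
    gcongr
    have h1 : (i : ℝ) / a ≤ 1 := (div_le_one ha).2 hi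
    have h2 : 0 ≤ (i : ℝ) / a := by positivity
    have h3 : 0 ≤ i / a * (1 - i / a) * τ := by
      have : 0 ≤ 1 - i / a := by linarith
      positivity
    have h4 : -(2 * i / a) * ξ - 2 * i / a * (2 - 2 * i / a) * τ =
      i * (-2 * ξ / a) - 4 * (i / a * (1 - i / a) * τ) := by ring
    linarith
  have e2 : exp (-2 * ξ - 2 * (2 - 2) * τ) = exp (-2 * ξ / a) ^ a := by
    rw [exp_rpow_eq ha]; ring_nf
  rw [e2]
  have hx : 0 < exp (-2 * ξ / a) := exp_pos _
  set x := exp (-2 * ξ / a)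
  have h3 : a ^ a * x ^ a ≤ (a * x) ^ i := by
    rw [← Real.mul_rpow ha.le hx.le, ← Real.rpow_natCast]
    exact Real.rpow_le_rpow_of_exponent_ge (by positivity) hy hi
  have h4 : a ^ i * exp (-(2 * i / a) * ξ - 2 * i / a * (2 - 2 * i / a) * τ) ≤ (a * x) ^ i := by
    rw [mul_pow]; gcongr
  have hE := exp_pos 1
  nlinarith

/-- Derivative bounds for a hierarchy `u_i' = c (i u_i + κ_i u_{i+1} - u_1 u_i)`: smallness of
finitely many members of the hierarchy at a point gives smallness of their derivatives there. -/
theorem exists_iteratedDeriv_hierarchy_le (K : ℝ) (k i : ℕ) (hi : 1 ≤ i) :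
    ∃ C : ℝ, 0 ≤ C ∧ ∀ (c : ℝ) (κ : ℕ → ℝ) (u : ℕ → ℝ → ℝ), (∀ j, |κ j| ≤ 1 + j) →
      (∀ j n : ℕ, ContDiff ℝ n (u j)) →
      (∀ j, 1 ≤ j → ∀ x, deriv (u j) x =
        c * (j * u j x + κ j * u (j + 1) x - u 1 x * u j x)) →
      ∀ ε x : ℝ, 0 ≤ ε → ε ≤ 1 → (∀ j, 1 ≤ j → j ≤ i + k → |u j x| ≤ K * ε) →
        |iteratedDeriv k (u i) x| ≤ C * |c| ^ k * ε := by
  induction k using Nat.strong_induction_on generalizing i with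
  | _ k ih =>
  cases k with
  | zero =>
    refine ⟨|K|, abs_nonneg K, fun c κ u _ _ _ ε x hε _ hu => ?_⟩
    simp only [iteratedDeriv_zero, pow_zero, mul_one]
    exact (hu i hi (by simp)).trans (by gcongr; exact le_abs_self K)
  | succ k =>
    choose! C hC0 hC using ih
    refine ⟨i * C k i + (1 + i) * C k (i + 1) +
        ∑ j ∈ Finset.range (k + 1), (k.choose j : ℝ) * C j 1 * C (k - j) i, ?_, ?_⟩
    · have h1 := hC0 k (by omega) i hi
      have h2 := hC0 k (by omega) (i + 1) (by omega)
      have h3 : ∀ j ∈ Finset.range (k + 1), 0 ≤ (k.choose j : ℝ) * C j 1 * C (k - j) i :=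
        fun j hj => by
          have := hC0 j (Finset.mem_range.1 hj) 1 le_rfl
          have := hC0 (k - j) (by omega) i hi
          positivity
      have := Finset.sum_nonneg h3
      positivity
    intro c κ u hκ hsm hode ε x hε hε1 hu
    have hb : ∀ l j : ℕ, l ≤ k → 1 ≤ j → j + l ≤ i + (k + 1) →
        |iteratedDeriv l (u j) x| ≤ C l j * |c| ^ l * ε := fun l j hl hj hlj =>
      hC l (by omega) j hj c κ u hκ hsm hode ε x hε hε1 fun j' h1 h2 => hu j' h1 (by omega)
    have hd : ∀ j, ContDiffAt ℝ k (u j) x := fun j => (hsm j k).contDiffAt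
    rw [iteratedDeriv_succ', funext (hode i hi), iteratedDeriv_const_mul_field,
      iteratedDeriv_fun_sub (((contDiffAt_const).mul (hd i)).add (contDiffAt_const.mul (hd (i + 1))))
        ((hd 1).mul (hd i)),
      iteratedDeriv_fun_add ((contDiffAt_const).mul (hd i)) (contDiffAt_const.mul (hd (i + 1))),
      iteratedDeriv_const_mul_field, iteratedDeriv_const_mul_field,
      iteratedDeriv_fun_mul (hd 1) (hd i), abs_mul]
    have t1 : |(i : ℝ) * iteratedDeriv k (u i) x| ≤ i * C k i * (|c| ^ k * ε) := by
      rw [abs_mul, Nat.abs_cast, mul_assoc]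
      refine mul_le_mul_of_nonneg_left ?_ (Nat.cast_nonneg _)
      rw [← mul_assoc]
      exact hb k i le_rfl hi (by omega)
    have t2 : |κ i * iteratedDeriv k (u (i + 1)) x| ≤ (1 + i) * C k (i + 1) * (|c| ^ k * ε) := by
      rw [abs_mul, mul_assoc]
      refine mul_le_mul (hκ i) ?_ (abs_nonneg _) (by positivity)
      rw [← mul_assoc]
      exact hb k (i + 1) le_rfl (by omega) (by omega)
    have t3 : |∑ j ∈ Finset.range (k + 1),
        (k.choose j : ℝ) * iteratedDeriv j (u 1) x * iteratedDeriv (k - j) (u i) x| ≤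
        (∑ j ∈ Finset.range (k + 1), (k.choose j : ℝ) * C j 1 * C (k - j) i) *
          (|c| ^ k * ε) := by
      rw [Finset.sum_mul]
      refine (Finset.abs_sum_le_sum_abs _ _).trans (Finset.sum_le_sum fun j hj => ?_)
      have hj : j ≤ k := by have := Finset.mem_range.1 hj; omega
      have b1 := hb j 1 hj le_rfl (by omega)
      have b2 := hb (k - j) i (by omega) hi (by omega)
      have c1 := hC0 j (by omega) 1 le_rfl
      have c2 := hC0 (k - j) (by omega) i hi
      rw [abs_mul, abs_mul, Nat.abs_cast]
      calc (k.choose j : ℝ) * |iteratedDeriv j (u 1) x| * |iteratedDeriv (k - j) (u i) x|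
          ≤ (k.choose j : ℝ) * (C j 1 * |c| ^ j * ε) * (C (k - j) i * |c| ^ (k - j) * ε) := by
            gcongr
        _ = (k.choose j : ℝ) * C j 1 * C (k - j) i * (|c| ^ (j + (k - j)) * (ε * ε)) := by
            rw [pow_add]; ring
        _ ≤ (k.choose j : ℝ) * C j 1 * C (k - j) i * (|c| ^ k * ε) := by
            rw [Nat.add_sub_cancel' hj]
            gcongr
            nlinarith
    calc _ ≤ |c| * (i * C k i * (|c| ^ k * ε) + (1 + i) * C k (i + 1) * (|c| ^ k * ε) +
          (∑ j ∈ Finset.range (k + 1), (k.choose j : ℝ) * C j 1 * C (k - j) i) *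
          (|c| ^ k * ε)) := by
          refine mul_le_mul_of_nonneg_left ?_ (abs_nonneg _)
          exact (abs_sub _ _).trans (add_le_add ((abs_add_le _ _).trans (add_le_add t1 t2)) t3)
      _ = _ := by rw [pow_succ]; ring

theorem cosh_div_rpow {a : ℝ} (ha : 0 < a) (η : ℝ) :
    Real.cosh (η / a) ^ a = 2 ^ (-a) * (exp η * shockWeight a 0 η) := by
  have h : Real.cosh (η / a) = 2⁻¹ * (exp (η / a) * (1 + exp (-2 * η / a))) := by
    rw [Real.cosh_eq, mul_add, ← Real.exp_add]
    ring_nf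
  rw [h, Real.mul_rpow (by norm_num) (by positivity), Real.mul_rpow (by positivity) (by positivity),
    ← Real.exp_mul, div_mul_cancel₀ _ ha.ne', Real.inv_rpow (by norm_num),
    Real.rpow_neg (by norm_num)]
  simp [shockWeight]

theorem psi_eq {a τ : ℝ} (ha : 0 < a) (hτ : 0 ≤ τ) (ξ : ℝ) :
    ψ a ξ τ = 2 ^ (-a) * exp (ξ + τ) * shockMoment a τ 0 ξ := by
  rcases hτ.eq_or_lt with rfl | hτ
  · simp [ψ, shockMoment, tiltedGaussian, cosh_div_rpow ha, mul_assoc]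
  · have hv : (2 * τ).toNNReal ≠ 0 := by
      simpa [Real.toNNReal_eq_zero] using hτ
    rw [ψ, if_neg hτ.ne', shockMoment, tiltedGaussian,
      ProbabilityTheory.integral_gaussianReal_eq_integral_smul hv,
      ← integral_add_left_eq_self _ ξ, ← integral_const_mul, ← integral_const_mul]
    congr 1
    ext z
    rw [cosh_div_rpow ha, ProbabilityTheory.gaussianPDFReal, Real.coe_toNNReal _ (by linarith),
      smul_eq_mul]
    have h1 : (4 * π * τ) ^ (-(1 : ℝ) / 2) = (√(2 * π * (2 * τ)))⁻¹ := by
      rw [Real.sqrt_eq_rpow, ← Real.rpow_neg (by positivity)]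
      ring_nf
    have h2 : exp (-(ξ - (ξ + z)) ^ 2 / (4 * τ)) * exp (ξ + z) =
        exp (ξ + τ) * exp (-(z - 2 * τ) ^ 2 / (2 * (2 * τ))) := by
      rw [← Real.exp_add, ← Real.exp_add]
      congr 1
      field_simp
      ring
    rw [h1]
    calc _ = (√(2 * π * (2 * τ)))⁻¹ * 2 ^ (-a) * shockWeight a 0 (ξ + z) *
          (exp (-(ξ - (ξ + z)) ^ 2 / (4 * τ)) * exp (ξ + z)) := by ring
      _ = _ := by rw [h2]; ring

theorem w_eq {a τ : ℝ} (ha : 0 < a) (hτ : 0 ≤ τ) (ξ : ℝ) :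
    w a ξ τ = 1 - 2 / a * (shockMoment a τ 1 ξ / shockMoment a τ 0 ξ) := by
  have hM : shockMoment a τ 0 ξ ≠ 0 := by linarith [one_le_shockMoment ha τ ξ]
  have hd := ((((hasDerivAt_id ξ).add_const τ).exp).const_mul (2 ^ (-a))).mul
    (hasDerivAt_shockMoment ha τ 0 ξ)
  have he : (fun y => ψ a y τ) = fun y => 2 ^ (-a) * exp (y + τ) * shockMoment a τ 0 y :=
    funext fun y => psi_eq ha hτ y
  rw [w, he, show deriv (fun y => 2 ^ (-a) * exp (y + τ) * shockMoment a τ 0 y) ξ = _ from hd.deriv,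
    psi_eq ha hτ]
  have h2 : (2 : ℝ) ^ (-a) ≠ 0 := by positivity
  simp only [id, Nat.cast_zero, zero_mul, zero_add, zero_div, sub_zero, one_mul, mul_one]
  field_simp
  ring

theorem psi_neg (a ξ τ : ℝ) : ψ a (-ξ) τ = ψ a ξ τ := by
  unfold ψ
  split_ifs
  · rw [neg_div, Real.cosh_neg]
  · rw [← integral_neg_eq_self]
    congr 2
    ext η
    rw [show -η / a = -(η / a) by ring, Real.cosh_neg]
    ring_nf

theorem w_neg (a ξ τ : ℝ) : w a (-ξ) τ = -w a ξ τ := by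
  have h : deriv (fun y => ψ a y τ) (-ξ) = -deriv (fun y => ψ a y τ) ξ := by
    have := deriv_comp_neg (fun y => ψ a y τ) ξ
    simp only [psi_neg] at this
    linarith
  rw [w, w, h, psi_neg, neg_div]

theorem tanh_eq_exp (y : ℝ) : Real.tanh y = 1 - 2 * (exp (-2 * y) / (1 + exp (-2 * y))) := by
  have h : exp (-2 * y) = exp (-y) * exp (-y) := by rw [← Real.exp_add]; ring_nf
  rw [Real.tanh_eq_sinh_div_cosh, Real.sinh_eq, Real.cosh_eq, h]
  have h2 : exp y * exp (-y) = 1 := by rw [← Real.exp_add]; simp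
  have := exp_pos y
  have := exp_pos (-y)
  field_simp
  linear_combination (2 * exp (-y)) * h2

theorem hasDerivAt_moment_ratio {a : ℝ} (ha : 0 < a) (τ : ℝ) (i : ℕ) (x : ℝ) :
    HasDerivAt (fun y => shockMoment a τ i y / shockMoment a τ 0 y)
      (-2 / a * (i * (shockMoment a τ i x / shockMoment a τ 0 x) +
        (1 - i / a) * (shockMoment a τ (i + 1) x / shockMoment a τ 0 x) -
        shockMoment a τ 1 x / shockMoment a τ 0 x *
          (shockMoment a τ i x / shockMoment a τ 0 x))) x := by
  have hM : shockMoment a τ 0 x ≠ 0 := by linarith [one_le_shockMoment ha τ x]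
  refine ((hasDerivAt_shockMoment ha τ i x).div (hasDerivAt_shockMoment ha τ 0 x) hM).congr_deriv ?_
  simp only [Nat.cast_zero, zero_mul, zero_add, zero_div, sub_zero, one_mul]
  field_simp
  ring

/-- Far to the right of the shock, the derivatives of `M₁ / M₀` are small. -/
theorem exists_iteratedDeriv_moment_ratio_le (m : ℕ) :
    ∃ C : ℝ, 0 ≤ C ∧ ∀ a τ ξ : ℝ, (m : ℝ) + 1 ≤ a → 0 ≤ τ → a * exp (-2 * ξ / a) ≤ 1 →
      |iteratedDeriv m (fun y => shockMoment a τ 1 y / shockMoment a τ 0 y) ξ| ≤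
        C * (2 / a) ^ m * (a * exp (-2 * ξ / a)) := by
  obtain ⟨C, hC, h⟩ := exists_iteratedDeriv_hierarchy_le (2 * exp 1) m 1 le_rfl
  refine ⟨C, hC, fun a τ ξ ha hτ hy => ?_⟩
  have hm : (0 : ℝ) ≤ m := Nat.cast_nonneg m
  have ha0 : 0 < a := by linarith
  have key := h (-2 / a) (fun j => 1 - j / a)
    (fun j y => shockMoment a τ j y / shockMoment a τ 0 y) (fun j => ?_) (fun j n => ?_)
    (fun j _ x => (hasDerivAt_moment_ratio ha0 τ j x).deriv)
    (a * exp (-2 * ξ / a)) ξ (by positivity) hy (fun j hj hjm => ?_)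
  · rwa [show |-2 / a| = 2 / a by rw [abs_div, abs_of_pos ha0]; simp] at key
  · have h1 : (j : ℝ) / a ≤ j := div_le_self (Nat.cast_nonneg j) (by linarith)
    have h2 : 0 ≤ (j : ℝ) / a := by positivity
    exact abs_le.2 ⟨by linarith, by linarith⟩
  · exact (contDiff_shockMoment ha0 τ j n).div (contDiff_shockMoment ha0 τ 0 n)
      fun x => by linarith [one_le_shockMoment ha0 τ x]
  · have hja : (j : ℝ) ≤ a := by
      have : (j : ℝ) ≤ 1 + m := by exact_mod_cast hjm
      linarith
    have h0 := shockMoment_nonneg ha0 τ j ξ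
    have h1 := one_le_shockMoment ha0 τ ξ
    rw [abs_of_nonneg (div_nonneg h0 (by linarith))]
    refine (div_le_self h0 h1).trans ((shockMoment_le ha0 hτ hja hy).trans ?_)
    gcongr
    exact pow_le_of_le_one (by positivity) hy (by omega)

theorem hasDerivAt_logistic (x : ℝ) :
    HasDerivAt (fun y => exp (-2 * y) / (1 + exp (-2 * y)))
      (-2 * (exp (-2 * x) / (1 + exp (-2 * x)) -
        exp (-2 * x) / (1 + exp (-2 * x)) * (exp (-2 * x) / (1 + exp (-2 * x))))) x := by
  have h : HasDerivAt (fun y : ℝ => exp (-2 * y)) (exp (-2 * x) * -2) x := by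
    simpa using ((hasDerivAt_id x).const_mul (-2)).exp
  have hp : 1 + exp (-2 * x) ≠ 0 := by positivity
  refine (h.div (h.const_add 1) hp).congr_deriv ?_
  field_simp
  ring

theorem contDiff_logistic (n : ℕ) :
    ContDiff ℝ n (fun y : ℝ => exp (-2 * y) / (1 + exp (-2 * y))) :=
  ContDiff.div (by fun_prop) (by fun_prop) fun x => by positivity

theorem exists_iteratedDeriv_logistic_le (m : ℕ) :
    ∃ C : ℝ, 0 ≤ C ∧ ∀ ξ : ℝ, 0 ≤ ξ →
      |iteratedDeriv m (fun y => exp (-2 * y) / (1 + exp (-2 * y))) ξ| ≤ C * exp (-2 * ξ) := by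
  obtain ⟨C, hC, h⟩ := exists_iteratedDeriv_hierarchy_le 1 m 1 le_rfl
  refine ⟨C * 2 ^ m, by positivity, fun ξ hξ => ?_⟩
  have key := h (-2) (fun _ => 0)
    (fun j y => if j = 1 then exp (-2 * y) / (1 + exp (-2 * y)) else 0)
    (fun j => by simp; positivity) (fun j n => ?_) (fun j _ x => ?_)
    (exp (-2 * ξ)) ξ (exp_pos _).le (Real.exp_le_one_iff.2 (by linarith)) (fun j _ _ => ?_)
  · simpa using key
  · by_cases hj : j = 1
    · simpa [hj] using contDiff_logistic n
    · simpa [hj] using contDiff_const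
  · by_cases hj : j = 1
    · simpa [hj] using (hasDerivAt_logistic x).deriv
    · simp [hj]
  · by_cases hj : j = 1
    · simp only [hj, if_true, one_mul]
      rw [abs_of_pos (by positivity)]
      exact div_le_self (exp_pos _).le (by linarith [exp_pos (-2 * ξ)])
    · simp [hj, (exp_pos _).le]

theorem iteratedDeriv_w_sub_tanh {a τ : ℝ} (ha : 0 < a) (hτ : 0 ≤ τ) (m : ℕ) (ξ : ℝ) :
    iteratedDeriv m (fun y => w a y τ - Real.tanh y) ξ =
      2 * iteratedDeriv m (fun y => exp (-2 * y) / (1 + exp (-2 * y))) ξ -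
      2 / a * iteratedDeriv m (fun y => shockMoment a τ 1 y / shockMoment a τ 0 y) ξ := by
  have e : (fun y => w a y τ - Real.tanh y) = fun y =>
      2 * (exp (-2 * y) / (1 + exp (-2 * y))) -
      2 / a * (shockMoment a τ 1 y / shockMoment a τ 0 y) := by
    ext y
    rw [w_eq ha hτ, tanh_eq_exp]
    ring
  have h1 : ContDiff ℝ m (fun y => shockMoment a τ 1 y / shockMoment a τ 0 y) :=
    (contDiff_shockMoment ha τ 1 m).div (contDiff_shockMoment ha τ 0 m)
      fun x => by linarith [one_le_shockMoment ha τ x]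
  rw [e, iteratedDeriv_fun_sub (contDiff_const.mul (contDiff_logistic m)).contDiffAt
    (contDiff_const.mul h1).contDiffAt, iteratedDeriv_const_mul_field,
    iteratedDeriv_const_mul_field]

theorem abs_iteratedDeriv_w_sub_tanh_neg (a τ : ℝ) (m : ℕ) (ξ : ℝ) :
    |iteratedDeriv m (fun y => w a y τ - Real.tanh y) (-ξ)| =
      |iteratedDeriv m (fun y => w a y τ - Real.tanh y) ξ| := by
  have h := iteratedDeriv_comp_neg m (fun y => w a y τ - Real.tanh y) ξ
  have e : (fun x => w a (-x) τ - Real.tanh (-x)) = fun x => -(w a x τ - Real.tanh x) := by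
    ext x; rw [w_neg, Real.tanh_neg]; ring
  rw [e, iteratedDeriv_fun_neg] at h
  rw [← abs_neg (iteratedDeriv m (fun y => w a y τ - Real.tanh y) ξ), h]
  simp [abs_mul]

theorem far_field_bound (δ : ℝ) (hδ : 0 < δ) (m : ℕ) :
    ∃ A C : ℝ, 0 < A ∧ 0 < C ∧ ∀ a : ℝ, A ≤ a → ∀ ξ : ℝ,
      (1 / 2) * (1 + δ) ^ 2 * a * Real.log a ≤ |ξ| → ∀ τ : ℝ, 0 ≤ τ →
        |iteratedDeriv m (fun y => w a y τ - Real.tanh y) ξ| ≤ C * a ^ (-(1 + (m : ℝ) + δ)) := by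
  obtain ⟨C₁, hC₁, h₁⟩ := exists_iteratedDeriv_moment_ratio_le m
  obtain ⟨C₂, hC₂, h₂⟩ := exists_iteratedDeriv_logistic_le m
  refine ⟨m + 1, 2 * C₂ + 2 ^ (m + 1) * C₁ + 1, by positivity, by positivity, ?_⟩
  intro a ha ξ hξ τ hτ
  wlog hpos : 0 ≤ ξ generalizing ξ with H
  · rw [← abs_iteratedDeriv_w_sub_tanh_neg]
    exact H (-ξ) (by rwa [abs_neg]) (by linarith)
  rw [abs_of_nonneg hpos] at hξ
  have hm : (0 : ℝ) ≤ m := Nat.cast_nonneg m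
  have ha0 : 0 < a := by linarith
  have hl : 0 ≤ Real.log a := Real.log_nonneg (by linarith)
  have hy : a * exp (-2 * ξ / a) ≤ a ^ (-δ) := by
    rw [Real.rpow_def_of_pos ha0]
    nth_rw 1 [← Real.exp_log ha0]
    rw [← Real.exp_add]
    gcongr
    have : (1 + δ) ^ 2 * Real.log a ≤ 2 * ξ / a := by
      rw [le_div_iff₀ ha0]; linarith
    have h3 : -2 * ξ / a = -(2 * ξ / a) := by ring
    rw [h3]
    nlinarith [mul_nonneg hδ.le hl, mul_nonneg (sq_nonneg δ) hl]
  have hy1 : a ^ (-δ) ≤ 1 := Real.rpow_le_one_of_one_le_of_nonpos (by linarith) (by linarith)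
  have b1 := h₁ a τ ξ ha hτ (hy.trans hy1)
  have b2 := h₂ ξ hpos
  have e1 : exp (-2 * ξ) ≤ a ^ (-(1 + (m : ℝ) + δ)) := by
    rw [Real.rpow_def_of_pos ha0, Real.exp_le_exp]
    have h4 : 1 + (m : ℝ) + δ ≤ (1 + δ) ^ 2 * a := by
      nlinarith [mul_nonneg hδ.le hm, sq_nonneg δ, mul_nonneg (sq_nonneg δ) ha0.le]
    nlinarith [mul_le_mul_of_nonneg_left h4 hl]
  have e2 : 2 / a * (C₁ * (2 / a) ^ m * (a * exp (-2 * ξ / a))) ≤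
      2 ^ (m + 1) * C₁ * a ^ (-(1 + (m : ℝ) + δ)) := by
    have h5 : a ^ (-(1 + (m : ℝ) + δ)) = (a ^ (m + 1))⁻¹ * a ^ (-δ) := by
      rw [← Real.rpow_natCast, ← Real.rpow_neg ha0.le, ← Real.rpow_add ha0]
      push_cast; ring_nf
    calc _ = 2 ^ (m + 1) * C₁ * ((a ^ (m + 1))⁻¹ * (a * exp (-2 * ξ / a))) := by
          rw [div_pow]; field_simp; ring
      _ ≤ _ := by rw [h5]; gcongr
  have hR : 0 < a ^ (-(1 + (m : ℝ) + δ)) := by positivity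
  rw [iteratedDeriv_w_sub_tanh ha0 hτ]
  refine (abs_sub _ _).trans ?_
  rw [abs_mul, abs_mul, abs_of_pos (by positivity : 0 < 2 / a), abs_two]
  have b1' := mul_le_mul_of_nonneg_left b1 (by positivity : 0 ≤ 2 / a)
  have b2' : C₂ * exp (-2 * ξ) ≤ C₂ * a ^ (-(1 + (m : ℝ) + δ)) := by gcongr
  linarith

theorem one_add_rpow_sub_one_le {a x : ℝ} (ha : 1 ≤ a) (hx : 0 < x) (hx1 : x ≤ 1) :
    (1 + x) ^ a - 1 ≤ 2 * a * x + 2 ^ a * a ^ (a / 4) * x ^ (a / 4) := by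
  have ha0 : 0 < a := by linarith
  rcases le_total (a * x) 1 with h | h
  · have h1 : (1 + x) ^ a ≤ exp (a * x) := by
      calc (1 + x) ^ a ≤ exp x ^ a := by gcongr; linarith [Real.add_one_le_exp x]
        _ = exp (a * x) := by rw [← Real.exp_mul, mul_comm]
    have hax : 0 ≤ a * x := by positivity
    have h2 := (abs_le.1 (Real.abs_exp_sub_one_le (by rwa [abs_of_nonneg hax]))).2
    rw [abs_of_nonneg hax] at h2
    have : 0 ≤ 2 ^ a * a ^ (a / 4) * x ^ (a / 4) := by positivity
    linarith
  · have h1 : (1 + x) ^ a ≤ 2 ^ a := by gcongr; linarith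
    have h2 : 1 ≤ a ^ (a / 4) * x ^ (a / 4) := by
      rw [← Real.mul_rpow ha0.le hx.le]
      exact Real.one_le_rpow h (by positivity)
    have h3 : (2 : ℝ) ^ a ≤ 2 ^ a * (a ^ (a / 4) * x ^ (a / 4)) :=
      le_mul_of_one_le_right (by positivity) h2
    have : 0 ≤ 2 * a * x := by positivity
    linarith

theorem one_add_rpow_remainder_le {a x : ℝ} (ha : 1 ≤ a) (hx : 0 < x) :
    (1 + x) ^ a - 1 - x ^ a ≤ 2 * a * (x + x ^ (a - 1)) +
      2 ^ a * a ^ (a / 4) * (x ^ (a / 4) + x ^ (3 * a / 4)) := by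
  have p1 : 0 < 2 ^ a * a ^ (a / 4) := by positivity
  have p2 : 0 < x ^ (a / 4) := by positivity
  have p3 : 0 < x ^ (3 * a / 4) := by positivity
  have p4 : 0 < x ^ (a - 1) := by positivity
  have p5 : 0 < x ^ a := by positivity
  have p6 := mul_pos p1 p2
  have p7 := mul_pos p1 p3
  have p8 : 0 < a * x := by positivity
  have p9 : 0 < a * x ^ (a - 1) := by positivity
  rcases le_total x 1 with h | h
  · have := one_add_rpow_sub_one_le ha hx h
    nlinarith
  · have h1 := mul_le_mul_of_nonneg_left
      (one_add_rpow_sub_one_le ha (inv_pos.2 hx) (inv_le_one_of_one_le₀ h)) p5.le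
    have e1 : x ^ a * (1 + x⁻¹) ^ a = (1 + x) ^ a := by
      rw [← Real.mul_rpow hx.le (by positivity)]
      congr 1; field_simp; ring
    have e2 : x ^ a * x⁻¹ = x ^ (a - 1) := by rw [Real.rpow_sub_one hx.ne']; rfl
    have e3 : x ^ a * x⁻¹ ^ (a / 4) = x ^ (3 * a / 4) := by
      rw [Real.inv_rpow hx.le, ← Real.rpow_neg hx.le, ← Real.rpow_add hx]
      ring_nf
    have e4 : x ^ a * (2 * a * x⁻¹ + 2 ^ a * a ^ (a / 4) * x⁻¹ ^ (a / 4)) =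
        2 * a * x ^ (a - 1) + 2 ^ a * a ^ (a / 4) * x ^ (3 * a / 4) := by
      rw [← e2, ← e3]; ring
    rw [mul_sub, e1, e4] at h1
    nlinarith

/-- The mass of `M₀` that comes neither from the left nor from the right end state. -/
theorem shockMoment_zero_remainder_le {a τ ξ : ℝ} (ha : 1 ≤ a) (hτ : 0 ≤ τ) (hξ : 0 ≤ ξ) :
    shockMoment a τ 0 ξ - 1 - exp (-2 * ξ) ≤ 4 * a * exp (-(4 / a * (1 - 1 / a) * τ)) +
      2 * (2 ^ a * a ^ (a / 4)) * exp (-(3 / 4 * τ)) := by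
  have ha0 : 0 < a := by linarith
  have hI := fun c => integrable_exp_tiltedGaussian τ c ξ
  have hpt : ∀ z, shockWeight a 0 (ξ + z) ≤ 1 + exp (-2 * (ξ + z)) +
      (2 * a * (exp (-(2 / a) * (ξ + z)) + exp (-(2 - 2 / a) * (ξ + z))) +
      2 ^ a * a ^ (a / 4) * (exp (-(1 / 2) * (ξ + z)) + exp (-(3 / 2) * (ξ + z)))) := by
    intro z
    have h := one_add_rpow_remainder_le ha (exp_pos (-2 * (ξ + z) / a))
    rw [exp_rpow_eq ha0, ← Real.exp_mul, ← Real.exp_mul, ← Real.exp_mul] at h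
    have e1 : -2 * (ξ + z) / a = -(2 / a) * (ξ + z) := by ring
    have e2 : -2 * (ξ + z) / a * (a - 1) = -(2 - 2 / a) * (ξ + z) := by field_simp
    have e3 : -2 * (ξ + z) / a * (a / 4) = -(1 / 2) * (ξ + z) := by field_simp; ring
    have e4 : -2 * (ξ + z) / a * (3 * a / 4) = -(3 / 2) * (ξ + z) := by field_simp; ring
    rw [e2, e3, e4] at h
    simp only [shockWeight, pow_zero, one_mul, Nat.cast_zero, sub_zero]
    rw [← e1]
    linarith
  have i1 : Integrable (fun z => 1 + exp (-2 * (ξ + z))) (tiltedGaussian τ) :=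
    (integrable_const 1).add (hI 2)
  have i2 : Integrable (fun z => 2 * a * (exp (-(2 / a) * (ξ + z)) +
      exp (-(2 - 2 / a) * (ξ + z)))) (tiltedGaussian τ) :=
    ((hI (2 / a)).add (hI (2 - 2 / a))).const_mul (2 * a)
  have i3 : Integrable (fun z => 2 ^ a * a ^ (a / 4) * (exp (-(1 / 2) * (ξ + z)) +
      exp (-(3 / 2) * (ξ + z)))) (tiltedGaussian τ) :=
    ((hI (1 / 2)).add (hI (3 / 2))).const_mul (2 ^ a * a ^ (a / 4))
  have i4 : Integrable (fun z => 2 * a * (exp (-(2 / a) * (ξ + z)) +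
      exp (-(2 - 2 / a) * (ξ + z))) + 2 ^ a * a ^ (a / 4) * (exp (-(1 / 2) * (ξ + z)) +
      exp (-(3 / 2) * (ξ + z)))) (tiltedGaussian τ) := i2.add i3
  have h := integral_mono (integrable_shockWeight ha0 τ 0 ξ) (i1.add i4) hpt
  simp only [Pi.add_apply] at h
  rw [integral_add i1 i4, integral_add (integrable_const _) (hI 2), integral_add i2 i3,
    integral_const_mul, integral_const_mul, integral_add (hI _) (hI _),
    integral_add (hI _) (hI _)] at h
  simp only [integral_exp_tiltedGaussian hτ] at h
  rw [integral_const, probReal_univ, one_smul] at h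
  have hi : 1 / a ≤ 1 := (div_le_one ha0).2 ha
  have hi' : 2 / a = 2 * (1 / a) := by ring
  have hd : ∀ c r : ℝ, 0 ≤ c → c * (2 - c) = r → exp (-c * ξ - c * (2 - c) * τ) ≤ exp (-(r * τ)) :=
    fun c r hc hr => by
      rw [hr]
      gcongr
      nlinarith [mul_nonneg hc hξ]
  have d1 := hd (2 / a) (4 / a * (1 - 1 / a)) (by positivity) (by ring)
  have d2 := hd (2 - 2 / a) (4 / a * (1 - 1 / a)) (by rw [hi']; linarith) (by ring)
  have d3 := hd (1 / 2) (3 / 4) (by norm_num) (by norm_num)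
  have d4 := hd (3 / 2) (3 / 4) (by norm_num) (by norm_num)
  have f1 := mul_le_mul_of_nonneg_left (add_le_add d1 d2) (by positivity : 0 ≤ 2 * a)
  have f2 := mul_le_mul_of_nonneg_left (add_le_add d3 d4)
    (by positivity : 0 ≤ 2 ^ a * a ^ (a / 4))
  have e0 : exp (-2 * ξ - 2 * (2 - 2) * τ) = exp (-2 * ξ) := by ring_nf
  rw [e0] at h
  have : shockMoment a τ 0 ξ ≤ _ := h
  linarith

theorem abs_w_sub_tanh_le {a τ : ℝ} (ha : 1 ≤ a) (hτ : 0 ≤ τ) (ξ : ℝ) :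
    |w a ξ τ - Real.tanh ξ| ≤ 2 * (shockMoment a τ 0 ξ - 1 - exp (-2 * ξ)) := by
  have ha0 : 0 < a := by linarith
  have hz := exp_pos (-2 * ξ)
  have hI := integrable_exp_tiltedGaussian τ 2 ξ
  have hW : ∀ z, a * exp (-2 * (ξ + z)) ≤ shockWeight a 1 (ξ + z) ∧
      shockWeight a 1 (ξ + z) ≤ a * (shockWeight a 0 (ξ + z) - 1) := by
    intro z
    rw [← exp_rpow_eq ha0]
    simp only [shockWeight, pow_zero, pow_one, one_mul, Nat.cast_zero, sub_zero, Nat.cast_one]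
    have hx := exp_pos (-2 * (ξ + z) / a)
    set x := exp (-2 * (ξ + z) / a)
    have h1 : x ^ a = x * x ^ (a - 1) := by
      rw [Real.rpow_sub_one hx.ne']; field_simp
    have h2 : (1 + x) ^ a = (1 + x) * (1 + x) ^ (a - 1) := by
      rw [Real.rpow_sub_one (by positivity)]; field_simp
    have h3 : x ^ (a - 1) ≤ (1 + x) ^ (a - 1) :=
      Real.rpow_le_rpow hx.le (by linarith) (by linarith)
    have h4 : 1 ≤ (1 + x) ^ (a - 1) := Real.one_le_rpow (by linarith) (by linarith)
    rw [h1, h2, mul_assoc]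
    constructor
    · gcongr
    · gcongr
      linarith
  have hlow : a * exp (-2 * ξ) ≤ shockMoment a τ 1 ξ := by
    have h := integral_mono (hI.const_mul a) (integrable_shockWeight ha0 τ 1 ξ) fun z => (hW z).1
    rw [integral_const_mul, integral_exp_tiltedGaussian hτ] at h
    simpa [shockMoment] using h
  have hup : shockMoment a τ 1 ξ ≤ a * (shockMoment a τ 0 ξ - 1) := by
    have h := integral_mono (integrable_shockWeight ha0 τ 1 ξ)
      (((integrable_shockWeight ha0 τ 0 ξ).sub (integrable_const 1)).const_mul a)
      fun z => (hW z).2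
    rw [integral_const_mul] at h
    simp only [Pi.sub_apply] at h
    rw [integral_sub (integrable_shockWeight ha0 τ 0 ξ) (integrable_const 1)] at h
    simpa [shockMoment] using h
  have hM := one_le_shockMoment ha0 τ ξ
  rw [w_eq ha0 hτ, tanh_eq_exp]
  set z := exp (-2 * ξ)
  set M := shockMoment a τ 0 ξ
  obtain ⟨N, hN⟩ : ∃ N, shockMoment a τ 1 ξ = a * N :=
    ⟨shockMoment a τ 1 ξ / a, by field_simp⟩
  rw [hN] at hlow hup ⊢
  have hN1 : z ≤ N := le_of_mul_le_mul_left hlow ha0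
  have hN2 : N ≤ M - 1 := le_of_mul_le_mul_left hup ha0
  have e : 1 - 2 / a * (a * N / M) - (1 - 2 * (z / (1 + z))) =
      2 * (z * M - N * (1 + z)) / (M * (1 + z)) := by
    field_simp
    ring
  rw [e, abs_div, abs_of_pos (by positivity : 0 < M * (1 + z)), div_le_iff₀ (by positivity), abs_le]
  have hB : 0 ≤ M - 1 - z := by linarith
  have hD : (M - 1 - z) * (1 + z) ≤ (M - 1 - z) * (M * (1 + z)) := by
    gcongr
    nlinarith
  constructor <;> nlinarith [mul_nonneg hB hz.le, mul_le_mul_of_nonneg_right hN2 hz.le,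
    mul_le_mul_of_nonneg_right hN1 hz.le]

theorem near_field_remainder_le {δ a τ : ℝ} (hδ : 0 < δ) (ha : exp 16 ≤ a)
    (hτ : (1 / 2) * (1 + δ) ^ 2 * a * Real.log a ≤ τ) :
    a * exp (-(4 / a * (1 - 1 / a) * τ)) ≤ a ^ (-(3 * δ + δ ^ 2)) * τ ^ (-(1 : ℝ) / 2) ∧
    2 ^ a * a ^ (a / 4) * exp (-(3 / 4 * τ)) ≤
      a ^ (-(3 * δ + δ ^ 2)) * τ ^ (-(1 : ℝ) / 2) := by
  have ha0 : 0 < a := (exp_pos _).trans_le ha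
  have ha16 : 17 ≤ a := by linarith [Real.add_one_le_exp 16]
  have hl : 16 ≤ Real.log a := (Real.le_log_iff_exp_le ha0).2 ha
  obtain ⟨s, rfl⟩ : ∃ s, τ = a * s := ⟨τ / a, by field_simp⟩
  have hs : (1 / 2) * (1 + δ) ^ 2 * Real.log a ≤ s := by
    refine le_of_mul_le_mul_left ?_ ha0
    linarith
  have hδl : 0 ≤ δ * Real.log a := by positivity
  have hδl2 : 0 ≤ δ ^ 2 * Real.log a := by positivity
  have hs2 : 1 / 2 * Real.log a ≤ s := by nlinarith
  have hs0 : 0 < s := by linarith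
  have hlog : Real.log (a * s) ≤ Real.log a + s := by
    rw [Real.log_mul ha0.ne' hs0.ne']
    linarith [Real.log_le_sub_one_of_pos hs0]
  have hR : a ^ (-(3 * δ + δ ^ 2)) * (a * s) ^ (-(1 : ℝ) / 2) =
      exp (Real.log a * (-(3 * δ + δ ^ 2)) + Real.log (a * s) * (-(1 : ℝ) / 2)) := by
    rw [Real.rpow_def_of_pos ha0, Real.rpow_def_of_pos (by positivity), ← Real.exp_add]
  rw [hR]
  constructor
  · nth_rw 1 [← Real.exp_log ha0]
    rw [← Real.exp_add, Real.exp_le_exp]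
    have h1 : 4 / a * (1 - 1 / a) * (a * s) = 4 * s - 4 / a * s := by field_simp
    have h2 : 4 / a * s ≤ 1 / 2 * s := by
      refine mul_le_mul_of_nonneg_right ?_ hs0.le
      rw [div_le_iff₀ ha0]
      linarith
    rw [h1]
    nlinarith
  · rw [Real.rpow_def_of_pos (by norm_num : (0 : ℝ) < 2), Real.rpow_def_of_pos ha0,
      ← Real.exp_add, ← Real.exp_add, Real.exp_le_exp]
    have hlog2 : Real.log 2 ≤ 1 := by linarith [Real.log_le_sub_one_of_pos (zero_lt_two' ℝ)]
    have h1 : Real.log 2 * a ≤ a := by nlinarith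
    have h2 : (3 / 4 * a - 7 / 2) * (1 / 2 * Real.log a) ≤ (3 / 4 * a - 7 / 2) * s := by
      gcongr
      linarith
    have h3 : 16 * a ≤ a * Real.log a := by nlinarith
    have h4 : 17 * Real.log a ≤ a * Real.log a := by nlinarith
    nlinarith

theorem near_field_bound {δ a τ : ℝ} (hδ : 0 < δ) (ha : exp 16 ≤ a)
    (hτ : (1 / 2) * (1 + δ) ^ 2 * a * Real.log a ≤ τ) (ξ : ℝ) :
    |w a ξ τ - Real.tanh ξ| ≤ 12 * a ^ (-(3 * δ + δ ^ 2)) * τ ^ (-(1 : ℝ) / 2) := by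
  wlog hpos : 0 ≤ ξ generalizing ξ with H
  · have h := H (-ξ) (by linarith)
    rwa [w_neg, Real.tanh_neg, neg_sub_neg, abs_sub_comm] at h
  have ha1 : 1 ≤ a := by linarith [Real.add_one_le_exp 16]
  have hl : 0 ≤ Real.log a := Real.log_nonneg ha1
  have hτ0 : 0 ≤ τ := le_trans (by positivity) hτ
  obtain ⟨h1, h2⟩ := near_field_remainder_le hδ ha hτ
  have h3 := abs_w_sub_tanh_le ha1 hτ0 ξ
  have h4 := shockMoment_zero_remainder_le ha1 hτ0 hpos
  linarith

/-- Lemma 5: convergence of the Burgers solution with data `tanh(ξ/a)` to the viscous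
shock `tanh(ξ)`: (i) uniform smallness `C a^{-(3δ+δ²)} τ^{-1/2}` for
`τ ≥ (1/2)(1+δ)² a log a`; (ii) smallness `C_m a^{-(1+m+δ)}` of all `ξ`-derivatives for
`|ξ| ≥ (1/2)(1+δ)² a log a` and all `τ ≥ 0`. -/
theorem shock_formation_general_a (δ : ℝ) (hδ : 0 < δ) :
    (∃ A C : ℝ, 0 < A ∧ 0 < C ∧
      ∀ a : ℝ, A ≤ a →
        ∀ τ : ℝ, (1/2) * (1 + δ) ^ 2 * a * Real.log a ≤ τ →
          ∀ ξ : ℝ, |w a ξ τ - Real.tanh ξ| ≤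
            C * a ^ (-(3 * δ + δ ^ 2)) * τ ^ (-(1:ℝ)/2)) ∧
    (∀ m : ℕ, ∃ Am Cm : ℝ, 0 < Am ∧ 0 < Cm ∧
      ∀ a : ℝ, Am ≤ a →
        ∀ ξ : ℝ, (1/2) * (1 + δ) ^ 2 * a * Real.log a ≤ |ξ| →
          ∀ τ : ℝ, 0 ≤ τ →
            |iteratedDeriv m (fun y => w a y τ - Real.tanh y) ξ| ≤
              Cm * a ^ (-(1 + (m:ℝ) + δ))) := by
  refine ⟨⟨exp 16, 12, exp_pos _, by norm_num, fun a ha τ hτ ξ => near_field_bound hδ ha hτ ξ⟩,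
    fun m => far_field_bound δ hδ m⟩
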